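/- Fix an integer ℓ ≥ 2 and a vector 𝐦 = (𝐦_S) of nonnegative integers indexed by unordered pairs of distinct elements of [ℓ], not all zero, and set σ = Σ_S 𝐦_S and P(n) = 2^n · Π_S (1/𝐦_S!)·(𝐦_S·n/σ)^{𝐦_S} (with the convention 0^0 = 1). Then there exists a constant C > 0 such that for every integer n ≥ 1, (1 − C/√n)·P(n) ≤ s*(n,ℓ,𝐦) ≤ (1 + C/√n)·P(n). -/

import Mathlib

open scoped Classical

noncomputable section

/-- The `𝐦`-overlapping property: for distinct `k1, k2` and `A ∈ 𝓕_{k1}`, `B ∈ 𝓕_{k2}`,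
`|A ∩ B| ≤ 𝐦_{k1,k2}`. -/
def Overlap {n ℓ : ℕ} (m : Fin ℓ → Fin ℓ → ℕ) (F : Fin ℓ → Finset (Finset (Fin n))) : Prop :=
  ∀ k1 k2 : Fin ℓ, k1 ≠ k2 → ∀ A ∈ F k1, ∀ B ∈ F k2, (A ∩ B).card ≤ m k1 k2

/-- `s*(n, ℓ, 𝐦)`: the maximum of `|𝓕_1|⋯|𝓕_ℓ|` over `𝐦`-overlapping tuples. -/
def sStar (n ℓ : ℕ) (m : Fin ℓ → Fin ℓ → ℕ) : ℕ :=
  sSup {P : ℕ | ∃ F : Fin ℓ → Finset (Finset (Fin n)), Overlap m F ∧ P = ∏ k, (F k).card}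

/-- The set of (representatives of) unordered pairs of distinct elements of `[ℓ]`. -/
def pairs (ℓ : ℕ) : Finset (Fin ℓ × Fin ℓ) :=
  (Finset.univ : Finset (Fin ℓ × Fin ℓ)).filter (fun p => p.1 < p.2)

section

variable {n ℓ : ℕ}

theorem card_filter_card_le {α : Type*} (V : Finset α) (d : ℕ) :
    (V.powerset.filter (fun A => A.card ≤ d)).card ≤ (V.card + d).choose d := by
  have h : V.powerset.filter (fun A => A.card ≤ d) ⊆
      (Finset.range (d + 1)).biUnion (fun i => Finset.powersetCard i V) := by
    intro A hA
    simp only [Finset.mem_filter, Finset.mem_powerset] at hA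
    simp only [Finset.mem_biUnion, Finset.mem_range, Finset.mem_powersetCard]
    exact ⟨A.card, by omega, hA.1, rfl⟩
  refine (Finset.card_le_card h).trans (Finset.card_biUnion_le.trans ?_)
  simp only [Finset.card_powersetCard]
  rw [Nat.add_choose_eq, Finset.Nat.sum_antidiagonal_eq_sum_range_succ_mk]
  refine Finset.sum_le_sum fun i hi => ?_
  exact Nat.le_mul_of_pos_right _ (Nat.choose_pos (by omega))

theorem exists_sup_family {m : Fin ℓ → Fin ℓ → ℕ} {F : Fin ℓ → Finset (Finset (Fin n))}
    (hF : Overlap m F) (V : Finset (Fin n)) (hV : ∀ k, F k ⊆ V.powerset) (s : Finset (Fin ℓ)) :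
    ∃ G : Finset (Finset (Fin n)), G ⊆ V.powerset ∧
      (∀ X ∈ G, ∃ A : Fin ℓ → Finset (Fin n), (∀ k ∈ s, A k ∈ F k) ∧ X ⊆ s.biUnion A) ∧
      ∏ k ∈ s, (F k).card ≤ G.card *
        ∏ j ∈ s, (V.card + ∑ k ∈ Finset.Iio j, m k j).choose (∑ k ∈ Finset.Iio j, m k j) := by
  induction s using Finset.induction_on_max with
  | empty => exact ⟨{∅}, by simp, by simp, by simp⟩
  | insert a s has ih =>
    obtain ⟨G, hGV, hG, hcard⟩ := ih
    have ha : a ∉ s := fun h => lt_irrefl _ (has a h)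
    refine ⟨Finset.image₂ (· ⊔ ·) (F a) G, ?_, ?_, ?_⟩
    · intro X hX
      obtain ⟨B, hB, C, hC, rfl⟩ := Finset.mem_image₂.1 hX
      exact Finset.mem_powerset.2 (Finset.union_subset (Finset.mem_powerset.1 (hV a hB))
        (Finset.mem_powerset.1 (hGV hC)))
    · intro X hX
      obtain ⟨B, hB, C, hC, rfl⟩ := Finset.mem_image₂.1 hX
      obtain ⟨A, hA, hCA⟩ := hG C hC
      refine ⟨Function.update A a B, ?_, ?_⟩
      · intro k hk
        rcases Finset.mem_insert.1 hk with rfl | hks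
        · simpa using hB
        · rw [Function.update_of_ne (by rintro rfl; exact ha hks)]
          exact hA k hks
      · rw [Finset.biUnion_insert, Function.update_self]
        refine Finset.union_subset_union le_rfl (hCA.trans ?_)
        refine Finset.biUnion_subset_iff_forall_subset.2 fun k hk => ?_
        intro x hx
        refine Finset.mem_biUnion.2 ⟨k, hk, ?_⟩
        rwa [Function.update_of_ne (by rintro rfl; exact ha hk)]
    · rw [Finset.prod_insert ha, Finset.prod_insert ha]
      set D := ∑ k ∈ Finset.Iio a, m k a
      have h1 : (Finset.image₂ (· ⊓ ·) (F a) G).card ≤ (V.card + D).choose D := by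
        refine le_trans (Finset.card_le_card ?_) (card_filter_card_le V D)
        intro X hX
        obtain ⟨B, hB, C, hC, rfl⟩ := Finset.mem_image₂.1 hX
        obtain ⟨A, hA, hCA⟩ := hG C hC
        refine Finset.mem_filter.2 ⟨Finset.mem_powerset.2
          (Finset.inter_subset_left.trans (Finset.mem_powerset.1 (hV a hB))), ?_⟩
        have h2 : B ⊓ C ⊆ s.biUnion (fun k => A k ∩ B) := by
          intro x hx
          have hx' := Finset.mem_inter.1 hx
          obtain ⟨k, hk, hxk⟩ := Finset.mem_biUnion.1 (hCA hx'.2)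
          exact Finset.mem_biUnion.2 ⟨k, hk, Finset.mem_inter.2 ⟨hxk, hx'.1⟩⟩
        refine (Finset.card_le_card h2).trans (Finset.card_biUnion_le.trans ?_)
        refine (Finset.sum_le_sum fun k hk =>
          hF k a (has k hk).ne (A k) (hA k hk) B hB).trans ?_
        exact Finset.sum_le_sum_of_subset fun k hk => Finset.mem_Iio.2 (has k hk)
      have h3 : (F a).card * G.card ≤ (Finset.image₂ (· ⊓ ·) (F a) G).card *
          (Finset.image₂ (· ⊔ ·) (F a) G).card := by
        exact Finset.le_card_infs_mul_card_sups (F a) G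
      refine (Nat.mul_le_mul_left _ hcard).trans ?_
      rw [← mul_assoc, ← mul_assoc]
      refine Nat.mul_le_mul_right _ (h3.trans ?_)
      rw [mul_comm (Finset.card _) (Nat.choose _ _)]
      exact Nat.mul_le_mul_right _ h1

theorem sum_pairs_eq (m : Fin ℓ → Fin ℓ → ℕ) :
    ∑ q ∈ pairs ℓ, m q.1 q.2 = ∑ j, ∑ k ∈ Finset.Iio j, m k j := by
  rw [pairs, Finset.sum_filter, Fintype.sum_prod_type_right]
  refine Finset.sum_congr rfl fun j _ => ?_
  rw [← Finset.sum_filter]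
  refine Finset.sum_congr ?_ fun _ _ => rfl
  ext; simp

theorem prod_card_le {m : Fin ℓ → Fin ℓ → ℕ} {F : Fin ℓ → Finset (Finset (Fin n))}
    (hF : Overlap m F) (V : Finset (Fin n)) (hV : ∀ k, F k ⊆ V.powerset) (hv : 1 ≤ V.card)
    {s : ℕ} (hs : ∑ q ∈ pairs ℓ, m q.1 q.2 ≤ s) :
    ∏ k, (F k).card ≤ (s + 1) ^ s * 2 ^ V.card * V.card ^ (∑ q ∈ pairs ℓ, m q.1 q.2) := by
  obtain ⟨G, hG, -, h⟩ := exists_sup_family hF V hV Finset.univ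
  have hGc : G.card ≤ 2 ^ V.card := by
    simpa [Finset.card_powerset] using Finset.card_le_card hG
  have hd : ∀ j, ∑ k ∈ Finset.Iio j, m k j ≤ s := fun j => by
    refine le_trans ?_ hs
    rw [sum_pairs_eq]
    exact Finset.single_le_sum (f := fun j => ∑ k ∈ Finset.Iio j, m k j)
      (fun _ _ => Nat.zero_le _) (Finset.mem_univ j)
  calc _ ≤ _ := h
    _ ≤ 2 ^ V.card * ∏ j, ((s + 1) * V.card) ^ (∑ k ∈ Finset.Iio j, m k j) := by
      refine Nat.mul_le_mul hGc (Finset.prod_le_prod' fun j _ => ?_)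
      refine (Nat.choose_le_pow _ _).trans (Nat.pow_le_pow_left ?_ _)
      nlinarith [hd j]
    _ = 2 ^ V.card * ((s + 1) * V.card) ^ (∑ q ∈ pairs ℓ, m q.1 q.2) := by
      rw [Finset.prod_pow_eq_pow_sum, sum_pairs_eq]
    _ ≤ 2 ^ V.card * ((s + 1) ^ s * V.card ^ (∑ q ∈ pairs ℓ, m q.1 q.2)) := by
      rw [mul_pow]
      gcongr
      omega
    _ = _ := by ring

theorem two_mul_card_pairs_within (T : Finset (Fin ℓ)) :
    2 * ((pairs ℓ).filter (fun p => p.1 ∈ T ∧ p.2 ∈ T)).card = T.card * T.card - T.card := by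
  rw [← Finset.offDiag_card, ← Finset.card_filter_add_card_filter_not (s := T.offDiag)
    (fun p => p.1 < p.2), two_mul]
  congr 1
  · congr 1
    ext ⟨a, b⟩
    simp only [pairs, Finset.mem_filter, Finset.mem_univ, true_and, Finset.mem_offDiag]
    constructor
    · rintro ⟨h, h1, h2⟩
      exact ⟨⟨h1, h2, h.ne⟩, h⟩
    · rintro ⟨⟨h1, h2, -⟩, h⟩
      exact ⟨h, h1, h2⟩
  · refine Finset.card_bij' (fun p _ => p.swap) (fun p _ => p.swap) ?_ ?_ ?_ ?_
    · rintro ⟨a, b⟩ h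
      simp only [pairs, Finset.mem_filter, Finset.mem_univ, true_and, Finset.mem_offDiag,
        Prod.swap, not_lt] at h ⊢
      exact ⟨⟨h.2.2, h.2.1, h.1.ne'⟩, h.1.le⟩
    · rintro ⟨a, b⟩ h
      simp only [pairs, Finset.mem_filter, Finset.mem_univ, true_and, Finset.mem_offDiag,
        Prod.swap, not_lt] at h ⊢
      exact ⟨lt_of_le_of_ne h.2 (Ne.symm h.1.2.2), h.1.2.1, h.1.1⟩
    · simp
    · simp

theorem pow_mul_prod_link_le {m : Fin ℓ → Fin ℓ → ℕ} {F : Fin ℓ → Finset (Finset (Fin n))}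
    (hF : Overlap m F) (V : Finset (Fin n)) (hV : ∀ k, F k ⊆ V.powerset) (hv : 1 ≤ V.card)
    {s : ℕ} (hs : ∑ q ∈ pairs ℓ, m q.1 q.2 = s) (T : Finset (Fin ℓ)) (e : Fin n) :
    V.card ^ ((pairs ℓ).filter (fun p => p.1 ∈ T ∧ p.2 ∈ T)).card *
      ∏ k, (if k ∈ T then ((F k).filter (fun A => e ∈ A)).card else (F k).card) ≤
    (s + 1) ^ s * 2 ^ V.card * V.card ^ s := by
  by_cases h0 : ∏ k, (if k ∈ T then ((F k).filter (fun A => e ∈ A)).card else (F k).card) = 0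
  · simp [h0]
  rw [← ne_eq, Finset.prod_ne_zero_iff] at h0
  have hne : ∀ k ∈ T, ∃ A ∈ F k, e ∈ A := by
    intro k hk
    have := h0 k (Finset.mem_univ k)
    rw [if_pos hk] at this
    obtain ⟨A, hA⟩ := Finset.card_pos.1 (Nat.pos_of_ne_zero this)
    exact ⟨A, (Finset.mem_filter.1 hA).1, (Finset.mem_filter.1 hA).2⟩
  let m' : Fin ℓ → Fin ℓ → ℕ := fun k j => if k ∈ T ∧ j ∈ T then m k j - 1 else m k j
  let L : Fin ℓ → Finset (Finset (Fin n)) := fun k =>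
    if k ∈ T then ((F k).filter (fun A => e ∈ A)).image (fun A => A.erase e) else F k
  have hmem : ∀ k, ∀ A ∈ L k, ∃ A' ∈ F k, A ⊆ A' ∧ (k ∈ T → e ∈ A' ∧ A = A'.erase e) := by
    intro k A hA
    by_cases hk : k ∈ T
    · simp only [L, if_pos hk, Finset.mem_image, Finset.mem_filter] at hA
      obtain ⟨A', ⟨h1, h2⟩, rfl⟩ := hA
      exact ⟨A', h1, Finset.erase_subset _ _, fun _ => ⟨h2, rfl⟩⟩
    · simp only [L, if_neg hk] at hA
      exact ⟨A, hA, le_rfl, fun h => absurd h hk⟩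
  have hL : Overlap m' L := by
    intro k j hkj A hA B hB
    obtain ⟨A', hA', hAA, hkT⟩ := hmem k A hA
    obtain ⟨B', hB', hBB, hjT⟩ := hmem j B hB
    have h1 := hF k j hkj A' hA' B' hB'
    by_cases h : k ∈ T ∧ j ∈ T
    · simp only [m', if_pos h]
      obtain ⟨h2, h3⟩ := hkT h.1
      obtain ⟨h4, h5⟩ := hjT h.2
      have h6 : A ∩ B ⊆ (A' ∩ B').erase e := by
        intro x hx
        subst h3 h5
        simp only [Finset.mem_inter, Finset.mem_erase] at hx ⊢
        tauto
      have h7 := Finset.card_le_card h6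
      rw [Finset.card_erase_of_mem (Finset.mem_inter.2 ⟨h2, h4⟩)] at h7
      omega
    · simp only [m', if_neg h]
      exact (Finset.card_le_card (Finset.inter_subset_inter hAA hBB)).trans h1
  have hLV : ∀ k, L k ⊆ V.powerset := by
    intro k A hA
    obtain ⟨A', hA', hAA, -⟩ := hmem k A hA
    exact Finset.mem_powerset.2 (hAA.trans (Finset.mem_powerset.1 (hV k hA')))
  have hLc : ∀ k, (L k).card =
      if k ∈ T then ((F k).filter (fun A => e ∈ A)).card else (F k).card := by
    intro k
    by_cases hk : k ∈ T
    · simp only [L, if_pos hk]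
      refine Finset.card_image_of_injOn ?_
      intro A hA B hB hAB
      simp only [Finset.coe_filter, Set.mem_ofPred_eq] at hA hB
      rw [← Finset.insert_erase hA.2, ← Finset.insert_erase hB.2]
      exact congrArg (insert e) hAB
    · simp only [L, if_neg hk]
  have hsum : ∑ q ∈ pairs ℓ, m' q.1 q.2 +
      ((pairs ℓ).filter (fun p => p.1 ∈ T ∧ p.2 ∈ T)).card = s := by
    rw [← hs, Finset.card_filter, ← Finset.sum_add_distrib]
    refine Finset.sum_congr rfl fun p hp => ?_
    have hlt : p.1 < p.2 := by simpa [pairs] using hp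
    by_cases h : p.1 ∈ T ∧ p.2 ∈ T
    · simp only [m', if_pos h]
      obtain ⟨A, hA, heA⟩ := hne _ h.1
      obtain ⟨B, hB, heB⟩ := hne _ h.2
      have h1 := hF _ _ hlt.ne A hA B hB
      have h2 : 0 < (A ∩ B).card := Finset.card_pos.2 ⟨e, Finset.mem_inter.2 ⟨heA, heB⟩⟩
      omega
    · simp only [m', if_neg h, add_zero]
  have := prod_card_le hL V hLV hv (s := s) (by omega)
  simp only [hLc] at this
  refine (Nat.mul_le_mul_left _ this).trans (le_of_eq ?_)
  rw [← hsum]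
  ring

theorem card_union_notMem_le {F : Finset (Finset (Fin n))} {β : ℝ} (D : Finset (Fin n))
    (hD : ∀ e ∈ D, ((F.filter (fun A => insert e A ∉ F)).card : ℝ) ≤ β) :
    ((F.filter (fun A => A ∪ D ∉ F)).card : ℝ) ≤ (2 ^ D.card - 1) * β := by
  induction D using Finset.induction_on with
  | empty =>
    have : F.filter (fun A => A ∪ ∅ ∉ F) = ∅ := by
      refine Finset.filter_eq_empty_iff.2 fun A hA => ?_
      simpa using hA
    rw [this]
    simp
  | insert e D he ih =>
    have h1 := ih fun x hx => hD x (Finset.mem_insert_of_mem hx)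
    have h2 := hD e (Finset.mem_insert_self e D)
    set N := F.filter (fun A => A ∪ D ∉ F)
    set B := F.filter (fun A => insert e A ∉ F)
    have hsub : F.filter (fun A => A ∪ insert e D ∉ F) ⊆
        B ∪ F.filter (fun A => insert e A ∈ N) := by
      intro A hA
      rw [Finset.mem_filter] at hA
      by_cases h : insert e A ∈ F
      · refine Finset.mem_union_right _ (Finset.mem_filter.2 ⟨hA.1, Finset.mem_filter.2 ⟨h, ?_⟩⟩)
        have : insert e A ∪ D = A ∪ insert e D := by
          ext; simp
        rw [this]
        exact hA.2
      · exact Finset.mem_union_left _ (Finset.mem_filter.2 ⟨hA.1, h⟩)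
    have hfib : (F.filter (fun A => insert e A ∈ N)).card ≤ 2 * N.card := by
      refine Finset.card_le_mul_card_image_of_maps_to (f := fun A => insert e A)
        (fun A hA => (Finset.mem_filter.1 hA).2) 2 ?_
      intro C _
      refine le_trans (Finset.card_le_card (t := {C, C.erase e}) ?_) Finset.card_le_two
      intro A hA
      obtain ⟨-, rfl⟩ := Finset.mem_filter.1 hA
      by_cases h : e ∈ A
      · simp [Finset.insert_eq_self.2 h]
      · simp [Finset.erase_insert h]
    have h3 := (Finset.card_le_card hsub).trans (Finset.card_union_le _ _)
    have h4 : ((F.filter (fun A => A ∪ insert e D ∉ F)).card : ℝ) ≤ B.card + 2 * N.card := by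
      exact_mod_cast h3.trans (Nat.add_le_add_left hfib _)
    rw [Finset.card_insert_of_notMem he, pow_succ]
    linarith

theorem card_filter_piFinset_le {α : Type*} {F : Fin ℓ → Finset α} {ρ : ℝ} (j : Fin ℓ)
    (Q : (Fin ℓ → α) → Prop) [DecidablePred Q]
    (hQ : ∀ A ∈ Fintype.piFinset F,
      (((F j).filter (fun Y => Q (Function.update A j Y))).card : ℝ) ≤ ρ * (F j).card) :
    (((Fintype.piFinset F).filter Q).card : ℝ) ≤ ρ * ∏ k, ((F k).card : ℝ) := by
  by_cases hj : (F j).card = 0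
  · have : (∏ k, ((F k).card : ℝ)) = 0 :=
      Finset.prod_eq_zero (Finset.mem_univ j) (by simp [hj])
    have h2 : Fintype.piFinset F = ∅ := by
      rw [← Finset.card_eq_zero, Fintype.card_piFinset]
      exact Finset.prod_eq_zero (Finset.mem_univ j) hj
    rw [this, h2]
    simp
  have hj' : (0 : ℝ) < (F j).card := by exact_mod_cast Nat.pos_of_ne_zero hj
  have hupd : ∀ A ∈ Fintype.piFinset F, ∀ Y ∈ F j,
      Function.update A j Y ∈ Fintype.piFinset F := by
    intro A hA Y hY
    rw [Fintype.mem_piFinset] at hA ⊢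
    intro k
    rcases eq_or_ne k j with rfl | hk
    · simpa using hY
    · simpa [Function.update_of_ne hk] using hA k
  have hcount : ((Fintype.piFinset F).filter Q).card * (F j).card =
      ∑ A ∈ Fintype.piFinset F, ((F j).filter (fun Y => Q (Function.update A j Y))).card := by
    rw [← Finset.card_product, ← Finset.card_sigma]
    refine Finset.card_bij' (fun x _ => ⟨Function.update x.1 j x.2, x.1 j⟩)
      (fun x _ => (Function.update x.1 j x.2, x.1 j)) ?_ ?_ ?_ ?_
    · rintro ⟨A, Y⟩ h
      simp only [Finset.mem_product, Finset.mem_filter, Finset.mem_sigma] at h ⊢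
      refine ⟨hupd A h.1.1 Y h.2, Fintype.mem_piFinset.1 h.1.1 j, ?_⟩
      simpa using h.1.2
    · rintro ⟨A, Y⟩ h
      simp only [Finset.mem_product, Finset.mem_filter, Finset.mem_sigma] at h ⊢
      exact ⟨⟨hupd A h.1 Y h.2.1, h.2.2⟩, Fintype.mem_piFinset.1 h.1 j⟩
    · rintro ⟨A, Y⟩ _
      simp
    · rintro ⟨A, Y⟩ _
      simp
  have h1 : (((Fintype.piFinset F).filter Q).card : ℝ) * (F j).card ≤
      ((Fintype.piFinset F).card : ℝ) * (ρ * (F j).card) := by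
    have : (((Fintype.piFinset F).filter Q).card : ℝ) * (F j).card =
        ∑ A ∈ Fintype.piFinset F,
          (((F j).filter (fun Y => Q (Function.update A j Y))).card : ℝ) := by
      exact_mod_cast hcount
    rw [this, ← nsmul_eq_mul]
    exact Finset.sum_le_card_nsmul _ _ _ hQ
  rw [Fintype.card_piFinset, Nat.cast_prod] at h1
  refine le_of_mul_le_mul_right (h1.trans (le_of_eq ?_)) hj'
  ring

theorem one_sub_sum_le_prod_one_sub {ι : Type*} (s : Finset ι) {p : ι → ℝ}
    (h0 : ∀ i ∈ s, 0 ≤ p i) (h1 : ∀ i ∈ s, p i ≤ 1) :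
    1 - ∑ i ∈ s, p i ≤ ∏ i ∈ s, (1 - p i) := by
  induction s using Finset.induction_on with
  | empty => simp
  | insert a s ha ih =>
    rw [Finset.sum_insert ha, Finset.prod_insert ha]
    have h2 := ih (fun i hi => h0 i (Finset.mem_insert_of_mem hi))
      (fun i hi => h1 i (Finset.mem_insert_of_mem hi))
    have h3 := h0 a (Finset.mem_insert_self a s)
    have h4 := h1 a (Finset.mem_insert_self a s)
    have h5 : 0 ≤ ∑ i ∈ s, p i :=
      Finset.sum_nonneg fun i hi => h0 i (Finset.mem_insert_of_mem hi)
    nlinarith [mul_le_mul_of_nonneg_left h2 (sub_nonneg.2 h4), mul_nonneg h3 h5]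

theorem exists_dominant_pair (hℓ : 2 ≤ ℓ) {p : Fin ℓ → ℝ} {K v : ℝ} (h0 : ∀ i, 0 ≤ p i)
    (h1 : ∀ i, p i ≤ 1) (hprod : ∏ i, (1 - p i) ≤ 1 / 2) (hK : 0 ≤ K) (hv : 0 ≤ v)
    (h2 : ∀ k j, k ≠ j → v * (p k * p j) ≤ K)
    (h3 : ∀ k j i, k ≠ j → k ≠ i → j ≠ i → v ^ 3 * (p k * p j * p i) ≤ K) :
    ∃ d t, d ≠ t ∧ v * (1 - 2 * p d) ≤ 4 * ℓ ^ 2 * K ∧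
      ∀ i, i ≠ d → i ≠ t → v * √v * p i ≤ 2 * ℓ * K + 1 := by
  have : NeZero ℓ := ⟨by omega⟩
  obtain ⟨d, -, hd⟩ := Finset.exists_max_image Finset.univ p ⟨0, Finset.mem_univ _⟩
  have hne : ((Finset.univ : Finset (Fin ℓ)).erase d).Nonempty := by
    rw [← Finset.card_pos, Finset.card_erase_of_mem (Finset.mem_univ d), Finset.card_fin]
    omega
  obtain ⟨t, ht, htmax⟩ := Finset.exists_max_image _ p hne
  have htd : t ≠ d := Finset.ne_of_mem_erase ht
  have hs := one_sub_sum_le_prod_one_sub Finset.univ (fun i _ => h0 i) (fun i _ => h1 i)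
  have hs2 : ∑ i, p i ≤ ℓ * p d := by
    simpa using Finset.sum_le_card_nsmul Finset.univ p (p d) hd
  have hpd : 1 ≤ 2 * ℓ * p d := by linarith
  have hsmall : ∀ j ∈ (Finset.univ : Finset (Fin ℓ)).erase d, v * p j ≤ 2 * ℓ * K := by
    intro j hj
    have h4 := h2 d j (Finset.ne_of_mem_erase hj).symm
    calc v * p j ≤ (2 * ℓ * p d) * (v * p j) :=
          le_mul_of_one_le_left (mul_nonneg hv (h0 j)) hpd
      _ = 2 * ℓ * (v * (p d * p j)) := by ring
      _ ≤ 2 * ℓ * K := by gcongr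
  refine ⟨d, t, htd.symm, ?_, ?_⟩
  · set R := ∑ j ∈ (Finset.univ : Finset (Fin ℓ)).erase d, p j with hR
    have hR0 : 0 ≤ R := Finset.sum_nonneg fun i _ => h0 i
    have hvR : v * R ≤ ℓ * (2 * ℓ * K) := by
      rw [hR, Finset.mul_sum]
      refine (Finset.sum_le_card_nsmul _ _ _ hsmall).trans ?_
      rw [nsmul_eq_mul]
      refine mul_le_mul_of_nonneg_right ?_ (by positivity)
      exact_mod_cast (Finset.card_erase_le).trans (by simp)
    have h4 := one_sub_sum_le_prod_one_sub ((Finset.univ : Finset (Fin ℓ)).erase d)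
      (fun i _ => h0 i) (fun i _ => h1 i)
    rw [← Finset.mul_prod_erase Finset.univ _ (Finset.mem_univ d)] at hprod
    have h5 := mul_le_mul_of_nonneg_left h4 (sub_nonneg.2 (h1 d))
    have h6 : 1 - 2 * p d ≤ 2 * R := by nlinarith [mul_nonneg (h0 d) hR0]
    nlinarith [mul_le_mul_of_nonneg_left h6 hv]
  · intro i hid hit
    have h4 := h3 d t i htd.symm hid.symm hit.symm
    have h5 : p i ≤ p t := htmax i (Finset.mem_erase.2 ⟨hid, Finset.mem_univ i⟩)
    have hℓK : 0 ≤ 2 * ℓ * K := by positivity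
    have h6 : v ^ 3 * (p i * p i) ≤ 2 * ℓ * K := by
      calc v ^ 3 * (p i * p i) ≤ v ^ 3 * (p t * p i) := by
            gcongr
            exact h0 i
        _ ≤ (2 * ℓ * p d) * (v ^ 3 * (p t * p i)) :=
          le_mul_of_one_le_left
            (mul_nonneg (pow_nonneg hv 3) (mul_nonneg (h0 t) (h0 i))) hpd
        _ = 2 * ℓ * (v ^ 3 * (p d * p t * p i)) := by ring
        _ ≤ _ := by gcongr
    have h7 : (v * √v * p i) ^ 2 ≤ (2 * ℓ * K + 1) ^ 2 := by
      have : (v * √v * p i) ^ 2 = v ^ 3 * (p i * p i) := by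
        rw [mul_pow, mul_pow, Real.sq_sqrt hv]
        ring
      rw [this]
      nlinarith
    exact le_of_sq_le_sq h7 (by positivity)

/-- The unordered pair `{a, b}`, written in increasing order. -/
def sortedPair (a b : Fin ℓ) : Fin ℓ × Fin ℓ := (min a b, max a b)

theorem sortedPair_mem_pairs {a b : Fin ℓ} (h : a ≠ b) : sortedPair a b ∈ pairs ℓ := by
  simp [pairs, sortedPair, h.symm]

theorem sortedPair_eq_iff {a b k j : Fin ℓ} (h : k < j) :
    sortedPair a b = (k, j) ↔ (a = k ∧ b = j) ∨ (a = j ∧ b = k) := by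
  simp only [sortedPair, Prod.mk.injEq]
  rcases le_total a b with hab | hab
  · rw [min_eq_left hab, max_eq_right hab]
    constructor
    · exact Or.inl
    · rintro (h' | ⟨rfl, rfl⟩)
      · exact h'
      · exact absurd hab h.not_ge
  · rw [min_eq_right hab, max_eq_left hab]
    constructor
    · exact fun h' => Or.inr h'.symm
    · rintro (⟨rfl, rfl⟩ | h')
      · exact absurd hab h.not_ge
      · exact h'.symm

theorem card_sparse_tuples_le (m : Fin ℓ → Fin ℓ → ℕ) {F : Fin ℓ → Finset (Finset (Fin n))}
    (V : Finset (Fin n)) (hV : ∀ k, F k ⊆ V.powerset) {d t : Fin n → Fin ℓ}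
    (hdt : ∀ e, d e ≠ t e) :
    ((Fintype.piFinset F).filter (fun A => (∀ i, ∀ e ∈ A i, i = d e ∨ i = t e) ∧
      ∀ p ∈ pairs ℓ, (V.filter (fun e => sortedPair (d e) (t e) = p ∧ e ∈ A (t e))).card ≤
        m p.1 p.2)).card ≤
    2 ^ V.card * ∏ p ∈ pairs ℓ,
      ((V.filter (fun e => sortedPair (d e) (t e) = p)).card + m p.1 p.2).choose (m p.1 p.2) := by
  set U : Fin ℓ × Fin ℓ → Finset (Fin n) := fun p =>
    V.filter (fun e => sortedPair (d e) (t e) = p) with hU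
  have hU0 : ∀ p, p ∉ pairs ℓ → U p = ∅ := by
    intro p hp
    refine Finset.filter_eq_empty_iff.2 ?_
    rintro e - rfl
    exact hp (sortedPair_mem_pairs (hdt e))
  have htarget : (V.powerset ×ˢ Fintype.piFinset
      (fun p => (U p).powerset.filter (fun B => B.card ≤ m p.1 p.2))).card ≤
      2 ^ V.card * ∏ p ∈ pairs ℓ, ((U p).card + m p.1 p.2).choose (m p.1 p.2) := by
    rw [Finset.card_product, Finset.card_powerset, Fintype.card_piFinset]
    refine Nat.mul_le_mul_left _ ?_
    refine (Finset.prod_le_prod' fun p _ => card_filter_card_le (U p) _).trans (le_of_eq ?_)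
    refine (Finset.prod_subset (Finset.subset_univ _) fun p _ hp => ?_).symm
    simp [hU0 p hp]
  refine le_trans ?_ htarget
  refine Finset.card_le_card_of_injOn (fun A => (V.filter (fun e => e ∈ A (d e)), fun p =>
    V.filter (fun e => sortedPair (d e) (t e) = p ∧ e ∈ A (t e)))) ?_ ?_
  · intro A hA
    have hA := (Finset.mem_filter.1 (Finset.mem_coe.1 hA)).2
    simp only [Finset.coe_product, Set.mem_prod, Finset.mem_coe, Finset.mem_powerset,
      Fintype.mem_piFinset, Finset.mem_filter, Finset.filter_subset, true_and]
    intro p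
    refine ⟨fun e he => ?_, ?_⟩
    · simp only [Finset.mem_filter, hU] at he ⊢
      exact ⟨he.1, he.2.1⟩
    · by_cases hp : p ∈ pairs ℓ
      · exact hA.2 p hp
      · have : V.filter (fun e => sortedPair (d e) (t e) = p ∧ e ∈ A (t e)) ⊆ U p := by
          intro e he
          simp only [Finset.mem_filter, hU] at he ⊢
          exact ⟨he.1, he.2.1⟩
        rw [hU0 p hp, Finset.subset_empty] at this
        simp [this]
  · have key : ∀ A ∈ Fintype.piFinset F, (∀ i, ∀ e ∈ A i, i = d e ∨ i = t e) →
        ∀ i e, e ∈ A i ↔ e ∈ V ∧ ((i = d e ∧ e ∈ V.filter (fun e => e ∈ A (d e))) ∨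
          (i = t e ∧ e ∈ V.filter (fun x => sortedPair (d x) (t x) = sortedPair (d e) (t e) ∧
            x ∈ A (t x)))) := by
      intro A hA h i e
      simp only [Finset.mem_filter, true_and]
      constructor
      · intro he
        have heV : e ∈ V :=
          Finset.mem_powerset.1 (hV i (Fintype.mem_piFinset.1 hA i)) he
        rcases h i e he with rfl | rfl
        · exact ⟨heV, Or.inl ⟨rfl, heV, he⟩⟩
        · exact ⟨heV, Or.inr ⟨rfl, heV, he⟩⟩
      · rintro ⟨-, ⟨rfl, -, h⟩ | ⟨rfl, -, h⟩⟩ <;> exact h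
    intro A hA B hB hAB
    have hA := Finset.mem_filter.1 (Finset.mem_coe.1 hA)
    have hB := Finset.mem_filter.1 (Finset.mem_coe.1 hB)
    simp only [Prod.mk.injEq] at hAB
    funext i
    ext e
    have h2 := congrFun hAB.2 (sortedPair (d e) (t e))
    rw [key A hA.1 hA.2.1, key B hB.1 hB.2.1, hAB.1, h2]

theorem card_notMem_insert_add_le {F : Finset (Finset (Fin n))}
    (hlow : ∀ A ∈ F, ∀ B ⊆ A, B ∈ F) (e : Fin n) :
    (F.filter (fun A => insert e A ∉ F)).card + 2 * (F.filter (fun A => e ∈ A)).card ≤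
      F.card := by
  have himg : ((F.filter (fun A => e ∈ A)).image (fun A => A.erase e)).card =
      (F.filter (fun A => e ∈ A)).card := by
    refine Finset.card_image_of_injOn ?_
    intro A hA B hB hAB
    simp only [Finset.coe_filter, Set.mem_ofPred_eq] at hA hB
    rw [← Finset.insert_erase hA.2, ← Finset.insert_erase hB.2]
    exact congrArg (insert e) hAB
  have h1 : (F.filter (fun A => insert e A ∉ F)) ∪
      ((F.filter (fun A => e ∈ A)).image (fun A => A.erase e)) ⊆ F.filter (fun A => e ∉ A) := by
    intro A hA
    rcases Finset.mem_union.1 hA with hA | hA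
    · rw [Finset.mem_filter] at hA ⊢
      refine ⟨hA.1, fun h => hA.2 ?_⟩
      rw [Finset.insert_eq_self.2 h]
      exact hA.1
    · obtain ⟨B, hB, rfl⟩ := Finset.mem_image.1 hA
      rw [Finset.mem_filter] at hB ⊢
      exact ⟨hlow B hB.1 _ (Finset.erase_subset _ _), Finset.notMem_erase _ _⟩
  have h2 : Disjoint (F.filter (fun A => insert e A ∉ F))
      ((F.filter (fun A => e ∈ A)).image (fun A => A.erase e)) := by
    rw [Finset.disjoint_left]
    intro A hA hA'
    obtain ⟨B, hB, rfl⟩ := Finset.mem_image.1 hA'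
    rw [Finset.mem_filter] at hA hB
    rw [Finset.insert_erase hB.2] at hA
    exact hA.2 hB.1
  have h3 := Finset.card_le_card h1
  rw [Finset.card_union_of_disjoint h2, himg] at h3
  have h4 := Finset.card_filter_add_card_filter_not (s := F) (fun A => e ∈ A)
  omega

theorem card_inter_sparse_le {m : Fin ℓ → Fin ℓ → ℕ} (hsym : ∀ k j, m k j = m j k)
    {F : Fin ℓ → Finset (Finset (Fin n))} (hF : Overlap m F) {k j : Fin ℓ} (hkj : k ≠ j)
    {X Y E₁ E₂ D₁ D₂ : Finset (Fin n)} (hX : X ∪ D₂ ∈ F k) (hY : Y ∪ D₁ ∈ F j)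
    (hE₁ : E₁ ⊆ X) (hE₂ : E₂ ⊆ Y) (hdisj : Disjoint E₁ E₂) (hD₁ : D₁ ⊆ E₁) (hD₂ : D₂ ⊆ E₂)
    (hc₁ : D₁.card = min (m k j + 1) E₁.card) (hc₂ : D₂.card = min (m j k + 1) E₂.card) :
    (E₁ ∪ E₂).card ≤ m k j := by
  have h1 := hF k j hkj _ hX _ hY
  have h2 : D₁ ∪ D₂ ⊆ (X ∪ D₂) ∩ (Y ∪ D₁) := by
    refine Finset.union_subset (Finset.subset_inter ?_ Finset.subset_union_right)
      (Finset.subset_inter Finset.subset_union_right ?_)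
    · exact (hD₁.trans hE₁).trans Finset.subset_union_left
    · exact (hD₂.trans hE₂).trans Finset.subset_union_left
  have h3 := Finset.card_le_card h2
  rw [Finset.card_union_of_disjoint (Finset.disjoint_of_subset_left hD₁
    (Finset.disjoint_of_subset_right hD₂ hdisj))] at h3
  rw [Finset.card_union_of_disjoint hdisj]
  rw [hsym j k] at hc₂
  omega

theorem pow_mul_prod_density_le {m : Fin ℓ → Fin ℓ → ℕ} {F : Fin ℓ → Finset (Finset (Fin n))}
    (hF : Overlap m F) (V : Finset (Fin n)) (hV : ∀ k, F k ⊆ V.powerset) (hv : 1 ≤ V.card)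
    {s : ℕ} (hs : ∑ q ∈ pairs ℓ, m q.1 q.2 = s) {c : ℝ} (hc : 0 < c)
    (hcM : c * (2 ^ V.card * (V.card : ℝ) ^ s) ≤ ∏ k, ((F k).card : ℝ))
    (T : Finset (Fin ℓ)) (e : Fin n) :
    (V.card : ℝ) ^ ((pairs ℓ).filter (fun p => p.1 ∈ T ∧ p.2 ∈ T)).card *
      ∏ k ∈ T, (((F k).filter (fun A => e ∈ A)).card : ℝ) / (F k).card ≤ (s + 1) ^ s / c := by
  have hv' : (0 : ℝ) < V.card := by exact_mod_cast hv
  have hMpos : 0 < ∏ k, ((F k).card : ℝ) := lt_of_lt_of_le (by positivity) hcM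
  have hpos : ∀ k, ((F k).card : ℝ) ≠ 0 := fun k =>
    (Finset.prod_ne_zero_iff.1 hMpos.ne') k (Finset.mem_univ k)
  have h1 := pow_mul_prod_link_le hF V hV hv hs T e
  have h2 : (∏ k, (if k ∈ T then (((F k).filter (fun A => e ∈ A)).card : ℝ) else (F k).card)) =
      (∏ k, ((F k).card : ℝ)) *
        ∏ k ∈ T, (((F k).filter (fun A => e ∈ A)).card : ℝ) / (F k).card := by
    rw [← Finset.univ_inter T, ← Finset.prod_ite_mem, ← Finset.prod_mul_distrib]
    refine Finset.prod_congr rfl fun k _ => ?_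
    simp only [Finset.univ_inter]
    split_ifs
    · rw [mul_div_cancel₀ _ (hpos k)]
    · rw [mul_one]
  have h3 : (V.card : ℝ) ^ ((pairs ℓ).filter (fun p => p.1 ∈ T ∧ p.2 ∈ T)).card *
      ∏ k, (if k ∈ T then (((F k).filter (fun A => e ∈ A)).card : ℝ) else (F k).card) ≤
      (s + 1) ^ s * 2 ^ V.card * V.card ^ s := by
    exact_mod_cast h1
  rw [h2] at h3
  rw [le_div_iff₀ hc]
  refine le_of_mul_le_mul_right ?_ (show (0 : ℝ) < 2 ^ V.card * (V.card : ℝ) ^ s by positivity)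
  set R := (V.card : ℝ) ^ ((pairs ℓ).filter (fun p => p.1 ∈ T ∧ p.2 ∈ T)).card *
      ∏ k ∈ T, (((F k).filter (fun A => e ∈ A)).card : ℝ) / (F k).card with hR
  have hR0 : 0 ≤ R := mul_nonneg (pow_nonneg hv'.le _)
    (Finset.prod_nonneg fun k _ => div_nonneg (Nat.cast_nonneg _) (Nat.cast_nonneg _))
  calc R * c * (2 ^ V.card * (V.card : ℝ) ^ s) = R * (c * (2 ^ V.card * (V.card : ℝ) ^ s)) := by
        ring
    _ ≤ R * ∏ k, ((F k).card : ℝ) := mul_le_mul_of_nonneg_left hcM hR0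
    _ = _ := by rw [hR]; ring
    _ ≤ _ := h3
    _ = _ := by ring

theorem exists_dominant_maps (hℓ : 2 ≤ ℓ) {m : Fin ℓ → Fin ℓ → ℕ}
    {F : Fin ℓ → Finset (Finset (Fin n))}
    (hF : Overlap m F) (V : Finset (Fin n)) (hV : ∀ k, F k ⊆ V.powerset) (hv : 1 ≤ V.card)
    {s : ℕ} (hs : ∑ q ∈ pairs ℓ, m q.1 q.2 = s) {c : ℝ} (hc : 0 < c)
    (hcM : c * (2 ^ V.card * (V.card : ℝ) ^ s) ≤ ∏ k, ((F k).card : ℝ))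
    (hE : ∀ e ∈ V, 2 * ∏ k, ((F k).filter (fun A => e ∉ A)).card ≤ ∏ k, (F k).card) :
    ∃ d t : Fin n → Fin ℓ, (∀ e, d e ≠ t e) ∧ ∀ e ∈ V,
      (V.card : ℝ) * ((F (d e)).card - 2 * ((F (d e)).filter (fun A => e ∈ A)).card) ≤
        4 * ℓ ^ 2 * ((s + 1) ^ s / c) * (F (d e)).card ∧
      ∀ i, i ≠ d e → i ≠ t e →
        (V.card : ℝ) * √(V.card : ℝ) * ((F i).filter (fun A => e ∈ A)).card ≤
          (2 * ℓ * ((s + 1) ^ s / c) + 1) * (F i).card := by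
  have hv' : (0 : ℝ) < V.card := by exact_mod_cast hv
  have hMpos : 0 < ∏ k, ((F k).card : ℝ) := lt_of_lt_of_le (by positivity) hcM
  have hpos : ∀ k, (0 : ℝ) < (F k).card := fun k => lt_of_le_of_ne (Nat.cast_nonneg _)
    ((Finset.prod_ne_zero_iff.1 hMpos.ne') k (Finset.mem_univ k)).symm
  set K : ℝ := (s + 1) ^ s / c
  have hK : 0 ≤ K := by positivity
  have hex : ∀ e, ∃ x : Fin ℓ × Fin ℓ, x.1 ≠ x.2 ∧ (e ∈ V →
      (V.card : ℝ) * ((F x.1).card - 2 * ((F x.1).filter (fun A => e ∈ A)).card) ≤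
        4 * ℓ ^ 2 * K * (F x.1).card ∧
      ∀ i, i ≠ x.1 → i ≠ x.2 →
        (V.card : ℝ) * √(V.card : ℝ) * ((F i).filter (fun A => e ∈ A)).card ≤
          (2 * ℓ * K + 1) * (F i).card) := by
    intro e
    by_cases he : e ∈ V
    swap
    · exact ⟨(⟨0, by omega⟩, ⟨1, by omega⟩), by simp, fun h => absurd h he⟩
    set p : Fin ℓ → ℝ := fun k => (((F k).filter (fun A => e ∈ A)).card : ℝ) / (F k).card
    have hp : ∀ k, (((F k).filter (fun A => e ∈ A)).card : ℝ) = p k * (F k).card := fun k =>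
      (div_mul_cancel₀ _ (hpos k).ne').symm
    have hprod : ∏ k, (1 - p k) ≤ 1 / 2 := by
      have h1 : ((2 * ∏ k, ((F k).filter (fun A => e ∉ A)).card : ℕ) : ℝ) ≤
          ((∏ k, (F k).card : ℕ) : ℝ) := by exact_mod_cast hE e he
      push_cast at h1
      have h2 : ∀ k, (((F k).filter (fun A => e ∉ A)).card : ℝ) = (F k).card * (1 - p k) := by
        intro k
        have h3 := Finset.card_filter_add_card_filter_not (s := F k) (fun A => e ∈ A)
        have h4 : (((F k).filter (fun A => e ∈ A)).card : ℝ) +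
          ((F k).filter (fun A => e ∉ A)).card = (F k).card := by exact_mod_cast h3
        rw [hp k] at h4
        linarith
      simp only [h2, Finset.prod_mul_distrib] at h1
      refine le_of_mul_le_mul_left ?_ hMpos
      linarith
    have hbound := fun T => pow_mul_prod_density_le hF V hV hv hs hc hcM T e
    obtain ⟨d, t, hdt, h1, h2⟩ := exists_dominant_pair hℓ (p := p) (K := K) (v := V.card)
      (fun k => div_nonneg (Nat.cast_nonneg _) (Nat.cast_nonneg _))
      (fun k => div_le_one_of_le₀ (by exact_mod_cast Finset.card_filter_le _ _)
        (Nat.cast_nonneg _))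
      hprod hK hv'.le
      (by
        intro k j hkj
        have h1 := hbound {k, j}
        have h2 := two_mul_card_pairs_within ({k, j} : Finset (Fin ℓ))
        rw [Finset.card_pair hkj] at h2
        have h3 : ((pairs ℓ).filter
          (fun p => p.1 ∈ ({k, j} : Finset (Fin ℓ)) ∧ p.2 ∈ ({k, j} : Finset (Fin ℓ)))).card
            = 1 := by omega
        rw [h3, Finset.prod_pair hkj, pow_one] at h1
        exact h1)
      (by
        intro k j i hkj hki hji
        have h1 := hbound {k, j, i}
        have h2 := two_mul_card_pairs_within ({k, j, i} : Finset (Fin ℓ))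
        rw [Finset.card_eq_three.2 ⟨k, j, i, hkj, hki, hji, rfl⟩] at h2
        have h3 : ((pairs ℓ).filter
          (fun p => p.1 ∈ ({k, j, i} : Finset (Fin ℓ)) ∧
            p.2 ∈ ({k, j, i} : Finset (Fin ℓ)))).card = 3 := by omega
        rw [h3, Finset.prod_insert (by simp [hkj, hki]), Finset.prod_pair hji, ← mul_assoc] at h1
        rw [mul_assoc] at h1
        rw [mul_assoc (p k)]
        exact h1)
    refine ⟨(d, t), hdt, fun _ => ⟨?_, fun i hid hit => ?_⟩⟩
    · simp only [hp]
      nlinarith [mul_le_mul_of_nonneg_right h1 (hpos d).le]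
    · rw [hp, ← mul_assoc]
      exact mul_le_mul_of_nonneg_right (h2 i hid hit) (hpos i).le
  choose x hx using hex
  exact ⟨fun e => (x e).1, fun e => (x e).2, fun e => (hx e).1, fun e he => (hx e).2 he⟩

theorem prod_card_le_of_dominant {m : Fin ℓ → Fin ℓ → ℕ} (hsym : ∀ k j, m k j = m j k)
    {F : Fin ℓ → Finset (Finset (Fin n))} (hF : Overlap m F)
    (hlow : ∀ k, ∀ A ∈ F k, ∀ B ⊆ A, B ∈ F k)
    (V : Finset (Fin n)) (hV : ∀ k, F k ⊆ V.powerset) (hv : 1 ≤ V.card)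
    {d t : Fin n → Fin ℓ} (hdt : ∀ e, d e ≠ t e) {K L : ℝ} (hK : 0 ≤ K)
    (hd : ∀ e ∈ V, (V.card : ℝ) * ((F (d e)).card -
      2 * ((F (d e)).filter (fun A => e ∈ A)).card) ≤ K * (F (d e)).card)
    (ht : ∀ e ∈ V, ∀ i, i ≠ d e → i ≠ t e → (V.card : ℝ) * √(V.card : ℝ) *
      ((F i).filter (fun A => e ∈ A)).card ≤ L * (F i).card) (hL : 0 ≤ L) :
    ∏ k, ((F k).card : ℝ) ≤ 2 ^ V.card * ∏ p ∈ pairs ℓ,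
      ((((V.filter (fun e => sortedPair (d e) (t e) = p)).card + m p.1 p.2).choose
        (m p.1 p.2) : ℕ) : ℝ) +
      (ℓ * L + (∑ k, ∑ j, (2 : ℝ) ^ (m k j + 1)) * K) / √(V.card : ℝ) *
        ∏ k, ((F k).card : ℝ) := by
  set v : ℝ := (V.card : ℝ) with hvdef
  have hv1 : (1 : ℝ) ≤ v := Nat.one_le_cast.2 hv
  have hv0 : 0 < v := by linarith
  set M := ∏ k, ((F k).card : ℝ) with hM
  have hM0 : 0 ≤ M := Finset.prod_nonneg fun _ _ => Nat.cast_nonneg _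
  have hsqrt : 0 < √v := Real.sqrt_pos.2 hv0
  have hD : ∀ k j : Fin ℓ, ∀ X : Finset (Fin n), ∃ D ⊆ X.filter (fun e => d e = j ∧ t e = k),
      D.card = min (m k j + 1) (X.filter (fun e => d e = j ∧ t e = k)).card := fun k j X =>
    Finset.exists_subset_card_eq (min_le_right _ _)
  choose D hDsub hDcard using hD
  set good := (Fintype.piFinset F).filter (fun A => (∀ i, ∀ e ∈ A i, i = d e ∨ i = t e) ∧
      ∀ p ∈ pairs ℓ, (V.filter (fun e => sortedPair (d e) (t e) = p ∧ e ∈ A (t e))).card ≤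
        m p.1 p.2)
  set bad₁ : Fin ℓ → Fin n → Finset (Fin ℓ → Finset (Fin n)) := fun i e =>
    (Fintype.piFinset F).filter (fun A => e ∈ A i)
  set bad₂ : Fin ℓ → Fin ℓ → Finset (Fin ℓ → Finset (Fin n)) := fun k j =>
    (Fintype.piFinset F).filter (fun A => A j ∪ D k j (A k) ∉ F j)
  have hAV : ∀ A ∈ Fintype.piFinset F, ∀ i, A i ⊆ V := fun A hA i =>
    Finset.mem_powerset.1 (hV i (Fintype.mem_piFinset.1 hA i))
  have hcover : Fintype.piFinset F ⊆ good ∪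
      ((Finset.univ.biUnion fun i => (V.filter (fun e => i ≠ d e ∧ i ≠ t e)).biUnion (bad₁ i)) ∪
       (Finset.univ.biUnion fun k => (Finset.univ.erase k).biUnion (bad₂ k))) := by
    intro A hA
    by_contra hcon
    simp only [Finset.mem_union, not_or, Finset.mem_biUnion, Finset.mem_univ, true_and,
      not_exists, not_and, Finset.mem_filter, bad₁, bad₂, Finset.mem_erase, and_true,
      and_imp, ne_eq, not_not] at hcon
    obtain ⟨hg, h1, h2⟩ := hcon
    refine hg (Finset.mem_filter.2 ⟨hA, ?_, ?_⟩)
    · intro i e he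
      by_contra hie
      rw [not_or] at hie
      exact h1 i e (hAV A hA i he) hie.1 hie.2 hA he
    · rintro ⟨k, j⟩ hp
      have hkj : k < j := by simpa [pairs] using hp
      have h3 := h2 k j hkj.ne' hA
      have h4 := h2 j k hkj.ne hA
      refine le_trans (Finset.card_le_card ?_) (card_inter_sparse_le hsym hF hkj.ne h4 h3
        (Finset.filter_subset _ _) (Finset.filter_subset _ _) ?_ (hDsub k j (A k))
        (hDsub j k (A j)) (hDcard k j (A k)) (hDcard j k (A j)))
      · intro e he
        obtain ⟨-, h5, h6⟩ := Finset.mem_filter.1 he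
        rcases (sortedPair_eq_iff hkj).1 h5 with ⟨rfl, rfl⟩ | ⟨rfl, rfl⟩
        · exact Finset.mem_union_right _ (Finset.mem_filter.2 ⟨h6, rfl, rfl⟩)
        · exact Finset.mem_union_left _ (Finset.mem_filter.2 ⟨h6, rfl, rfl⟩)
      · rw [Finset.disjoint_left]
        intro e he he'
        have h5 := (Finset.mem_filter.1 he).2.1
        have h6 := (Finset.mem_filter.1 he').2.1
        exact hkj.ne (h6.symm.trans h5)
  have hb₁ : ∀ i, ∀ e ∈ V.filter (fun e => i ≠ d e ∧ i ≠ t e),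
      ((bad₁ i e).card : ℝ) ≤ L / (v * √v) * M := by
    intro i e he
    obtain ⟨heV, hid, hit⟩ := Finset.mem_filter.1 he
    refine card_filter_piFinset_le (ρ := L / (v * √v)) i (fun A => e ∈ A i) fun A _ => ?_
    simp only [Function.update_self]
    rw [div_mul_eq_mul_div, le_div_iff₀ (mul_pos hv0 hsqrt), mul_comm]
    exact ht e heV i hid hit
  have hb₂ : ∀ k, ∀ j ∈ Finset.univ.erase k,
      ((bad₂ k j).card : ℝ) ≤ 2 ^ (m k j + 1) * (K / v) * M := by
    intro k j hj
    have hjk : k ≠ j := (Finset.ne_of_mem_erase hj).symm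
    refine card_filter_piFinset_le (ρ := 2 ^ (m k j + 1) * (K / v)) j
      (fun A => A j ∪ D k j (A k) ∉ F j) fun A hA => ?_
    simp only [Function.update_self, Function.update_of_ne hjk]
    have hβ : 0 ≤ K / v * (F j).card := mul_nonneg (div_nonneg hK hv0.le) (Nat.cast_nonneg _)
    refine (card_union_notMem_le (β := K / v * (F j).card) (D k j (A k)) ?_).trans ?_
    · intro e he
      obtain ⟨heA, rfl, rfl⟩ := Finset.mem_filter.1 (hDsub k j (A k) he)
      have h1 := card_notMem_insert_add_le (hlow (d e)) e
      have h2 : (((F (d e)).filter (fun A => insert e A ∉ F (d e))).card : ℝ) +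
          2 * ((F (d e)).filter (fun A => e ∈ A)).card ≤ (F (d e)).card := by exact_mod_cast h1
      have h3 := hd e (hAV A hA _ heA)
      rw [div_mul_eq_mul_div, le_div_iff₀ hv0]
      nlinarith [mul_le_mul_of_nonneg_left h2 hv0.le]
    · rw [mul_assoc]
      refine mul_le_mul_of_nonneg_right ?_ hβ
      have : (2 : ℝ) ^ (D k j (A k)).card ≤ 2 ^ (m k j + 1) := by
        refine pow_le_pow_right₀ (by norm_num) ?_
        rw [hDcard]
        exact min_le_left _ _
      linarith
  have hs₁ : ∑ i : Fin ℓ, ∑ e ∈ V.filter (fun e => i ≠ d e ∧ i ≠ t e),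
      ((bad₁ i e).card : ℝ) ≤ ℓ * L / √v * M := by
    have hnn : 0 ≤ L / (v * √v) * M :=
      mul_nonneg (div_nonneg hL (mul_pos hv0 hsqrt).le) hM0
    have h1 : ∀ i : Fin ℓ, ∑ e ∈ V.filter (fun e => i ≠ d e ∧ i ≠ t e),
        ((bad₁ i e).card : ℝ) ≤ v * (L / (v * √v) * M) := by
      intro i
      refine (Finset.sum_le_card_nsmul _ _ _ (hb₁ i)).trans ?_
      rw [nsmul_eq_mul]
      refine mul_le_mul_of_nonneg_right ?_ hnn
      exact Nat.cast_le.2 (Finset.card_filter_le _ _)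
    refine (Finset.sum_le_card_nsmul _ _ _ fun i _ => h1 i).trans (le_of_eq ?_)
    rw [nsmul_eq_mul, Finset.card_univ, Fintype.card_fin]
    field_simp
  have hs₂ : ∑ k : Fin ℓ, ∑ j ∈ Finset.univ.erase k, ((bad₂ k j).card : ℝ) ≤
      (∑ k, ∑ j, (2 : ℝ) ^ (m k j + 1)) * K / √v * M := by
    have h1 : ∀ k, ∑ j ∈ Finset.univ.erase k, ((bad₂ k j).card : ℝ) ≤
        ∑ j, 2 ^ (m k j + 1) * (K / v) * M := fun k =>
      (Finset.sum_le_sum (hb₂ k)).trans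
        (Finset.sum_le_sum_of_subset_of_nonneg (Finset.subset_univ _)
          fun j _ _ => mul_nonneg (mul_nonneg (pow_nonneg zero_le_two _)
            (div_nonneg hK hv0.le)) hM0)
    refine (Finset.sum_le_sum fun k _ => h1 k).trans ?_
    simp only [← Finset.sum_mul]
    refine mul_le_mul_of_nonneg_right ?_ hM0
    rw [mul_div_assoc]
    refine mul_le_mul_of_nonneg_left ?_ (Finset.sum_nonneg fun _ _ =>
      Finset.sum_nonneg fun _ _ => pow_nonneg zero_le_two _)
    refine div_le_div_of_nonneg_left hK hsqrt ?_
    rw [Real.sqrt_le_left hv0.le]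
    nlinarith
  have hgood := card_sparse_tuples_le m V hV hdt
  have htot : ((Fintype.piFinset F).card : ℝ) ≤ good.card +
      (∑ i : Fin ℓ, ∑ e ∈ V.filter (fun e => i ≠ d e ∧ i ≠ t e), ((bad₁ i e).card : ℝ) +
       ∑ k : Fin ℓ, ∑ j ∈ Finset.univ.erase k, ((bad₂ k j).card : ℝ)) := by
    have h1 := (Finset.card_le_card hcover).trans (Finset.card_union_le _ _)
    have h2 := h1.trans (Nat.add_le_add_left (Finset.card_union_le _ _) _)
    have h3 := h2.trans (Nat.add_le_add_left (Nat.add_le_add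
      (Finset.card_biUnion_le.trans (Finset.sum_le_sum fun i _ => Finset.card_biUnion_le))
      (Finset.card_biUnion_le.trans (Finset.sum_le_sum fun i _ => Finset.card_biUnion_le))) _)
    exact_mod_cast h3
  rw [Fintype.card_piFinset, Nat.cast_prod] at htot
  have hgood' : (good.card : ℝ) ≤ 2 ^ V.card * ∏ p ∈ pairs ℓ,
      ((((V.filter (fun e => sortedPair (d e) (t e) = p)).card + m p.1 p.2).choose
        (m p.1 p.2) : ℕ) : ℝ) := by exact_mod_cast hgood
  rw [add_div, add_mul]
  linarith

theorem prod_pow_le_of_sum_le {ι : Type*} (s : Finset ι) (a : ι → ℕ) {w : ι → ℝ}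
    (hw : ∀ i ∈ s, 0 ≤ w i) {N : ℝ} (hN : 0 < N) {σ : ℕ} (hσ : 0 < σ)
    (ha : ∑ i ∈ s, a i = σ) (hsum : ∑ i ∈ s, w i ≤ N) :
    ∏ i ∈ s, w i ^ a i ≤ ∏ i ∈ s, ((a i : ℝ) * N / σ) ^ a i := by
  have hσ' : (0 : ℝ) < σ := by exact_mod_cast hσ
  have key : ∀ i ∈ s, w i ^ a i ≤
      ((a i : ℝ) * N / σ) ^ a i * Real.exp (w i * σ / N - a i) := by
    intro i hi
    rcases Nat.eq_zero_or_pos (a i) with h0 | hpos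
    · have h1 : 0 ≤ w i * σ / N := div_nonneg (mul_nonneg (hw i hi) hσ'.le) hN.le
      simpa [h0] using h1
    · have hpos' : (0 : ℝ) < a i := by exact_mod_cast hpos
      set y := w i * σ / (N * a i) with hy
      have hy0 : 0 ≤ y := div_nonneg (mul_nonneg (hw i hi) hσ'.le) (mul_pos hN hpos').le
      have h1 : w i = ((a i : ℝ) * N / σ) * y := by
        rw [hy]
        field_simp
      have h2 : w i * σ / N - a i = a i * (y - 1) := by
        rw [hy]
        field_simp
      rw [h2, Real.exp_nat_mul, ← mul_pow]
      refine pow_le_pow_left₀ (hw i hi) ?_ _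
      nth_rewrite 1 [h1]
      refine mul_le_mul_of_nonneg_left ?_ (by positivity)
      linarith [Real.add_one_le_exp (y - 1)]
  refine (Finset.prod_le_prod (fun i hi => pow_nonneg (hw i hi) _) key).trans ?_
  rw [Finset.prod_mul_distrib, ← Real.exp_sum]
  refine mul_le_of_le_one_right (Finset.prod_nonneg fun i _ => by positivity) ?_
  rw [Real.exp_le_one_iff, Finset.sum_sub_distrib, ← Finset.sum_div, ← Finset.sum_mul,
    ← Nat.cast_sum, ha, sub_nonpos, div_le_iff₀ hN, mul_comm]
  exact mul_le_mul_of_nonneg_left hsum hσ'.le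

theorem prod_mul_div_pow {ι : Type*} (s : Finset ι) (a : ι → ℕ) (N : ℝ) {σ : ℕ}
    (ha : ∑ i ∈ s, a i = σ) :
    ∏ i ∈ s, ((Nat.factorial (a i) : ℝ))⁻¹ * ((a i : ℝ) * N / σ) ^ a i =
      (∏ i ∈ s, ((Nat.factorial (a i) : ℝ))⁻¹ * ((a i : ℝ) / σ) ^ a i) * N ^ σ := by
  rw [← ha, ← Finset.prod_pow_eq_pow_sum, ← Finset.prod_mul_distrib]
  refine Finset.prod_congr rfl fun i _ => ?_
  rw [mul_assoc, ← mul_pow, div_mul_eq_mul_div]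

theorem prod_choose_le {ι : Type*} (s : Finset ι) (a u : ι → ℕ) {σ : ℕ} (hσ : 0 < σ)
    (ha : ∑ i ∈ s, a i = σ) {v : ℕ} (hu : ∑ i ∈ s, u i ≤ v) :
    ∏ i ∈ s, (((u i + a i).choose (a i) : ℕ) : ℝ) ≤
      (∏ i ∈ s, ((Nat.factorial (a i) : ℝ))⁻¹ * ((a i : ℝ) / σ) ^ a i) * (v + σ) ^ σ := by
  have hN : (0 : ℝ) < v + σ := by positivity
  have h1 := prod_pow_le_of_sum_le s a (w := fun i => (u i : ℝ) + a i)
    (fun i _ => by positivity) hN hσ ha (by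
      rw [Finset.sum_add_distrib]
      exact_mod_cast (by omega : ∑ i ∈ s, u i + ∑ i ∈ s, a i ≤ v + σ))
  rw [← prod_mul_div_pow s a _ ha]
  calc _ ≤ ∏ i ∈ s, ((Nat.factorial (a i) : ℝ))⁻¹ * ((u i : ℝ) + a i) ^ a i := by
        refine Finset.prod_le_prod (fun i _ => Nat.cast_nonneg _) fun i _ => ?_
        refine (Nat.choose_le_pow_div (α := ℝ) _ _).trans (le_of_eq ?_)
        push_cast
        rw [div_eq_inv_mul]
    _ ≤ _ := by
        rw [Finset.prod_mul_distrib, Finset.prod_mul_distrib]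
        exact mul_le_mul_of_nonneg_left h1 (Finset.prod_nonneg fun i _ => by positivity)

theorem add_pow_le_one_add_div_mul {σ v : ℕ} (hv : 1 ≤ v) :
    ((v : ℝ) + σ) ^ σ ≤ (1 + (1 + σ : ℝ) ^ σ * σ * σ / √(v : ℝ)) * (v : ℝ) ^ σ := by
  have hv' : (1 : ℝ) ≤ v := by exact_mod_cast hv
  have hv0 : (0 : ℝ) < v := by linarith
  have hx : ∀ k : ℕ, ∀ x : ℝ, 0 ≤ x → x ≤ σ → (1 + x) ^ k ≤ 1 + (1 + σ : ℝ) ^ k * k * x := by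
    intro k x h0 h1
    induction k with
    | zero => simp
    | succ k ih =>
      have h2 : (1 + x) ^ k ≤ (1 + σ : ℝ) ^ k := by gcongr
      have h3 : (1 + σ : ℝ) ^ k ≤ (1 + σ : ℝ) ^ (k + 1) :=
        pow_le_pow_right₀ (by linarith) (by omega)
      have h4 : (1 + σ : ℝ) ^ k * k * x ≤ (1 + σ : ℝ) ^ (k + 1) * k * x := by gcongr
      have h5 : (1 + x) ^ k * x ≤ (1 + σ : ℝ) ^ (k + 1) * x := by
        gcongr
        exact h2.trans h3
      rw [pow_succ]
      push_cast
      linarith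
  have h1 : (σ : ℝ) / v ≤ σ := div_le_self (Nat.cast_nonneg _) hv'
  have h2 := hx σ _ (div_nonneg (Nat.cast_nonneg σ) hv0.le) h1
  have h3 : √(v : ℝ) ≤ v := by
    rw [Real.sqrt_le_left hv0.le]
    nlinarith
  calc ((v : ℝ) + σ) ^ σ = (1 + σ / v) ^ σ * (v : ℝ) ^ σ := by
        rw [← mul_pow]
        congr 1
        field_simp
    _ ≤ (1 + (1 + σ : ℝ) ^ σ * σ * (σ / v)) * (v : ℝ) ^ σ := by gcongr
    _ ≤ _ := by
        rw [← mul_div_assoc]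
        gcongr

theorem pow_div_sqrt_mono {σ v n : ℕ} (hσ : 0 < σ) (hv : 1 ≤ v) (hvn : v ≤ n) :
    (v : ℝ) ^ σ / √(v : ℝ) ≤ (n : ℝ) ^ σ / √(n : ℝ) := by
  have hv' : (0 : ℝ) < v := by exact_mod_cast hv
  have key : ∀ x : ℝ, 0 < x → x ^ σ / √x = x ^ (σ - 1) * √x := by
    intro x hx
    rw [div_eq_iff (Real.sqrt_pos.2 hx).ne', mul_assoc, Real.mul_self_sqrt hx.le, ← pow_succ,
      Nat.sub_add_cancel hσ]
  have hvn' : (v : ℝ) ≤ n := by exact_mod_cast hvn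
  rw [key _ hv', key _ (hv'.trans_le hvn')]
  gcongr

theorem exists_lower_overlap {m : Fin ℓ → Fin ℓ → ℕ} {F : Fin ℓ → Finset (Finset (Fin n))}
    (hF : Overlap m F) : ∃ G : Fin ℓ → Finset (Finset (Fin n)), Overlap m G ∧
      (∀ k, ∀ A ∈ G k, ∀ B ⊆ A, B ∈ G k) ∧ ∀ k, F k ⊆ G k := by
  refine ⟨fun k => Finset.univ.filter (fun A => ∃ B ∈ F k, A ⊆ B), ?_, ?_, ?_⟩
  · intro k j hkj A hA B hB
    obtain ⟨A', hA', hAA⟩ := (Finset.mem_filter.1 hA).2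
    obtain ⟨B', hB', hBB⟩ := (Finset.mem_filter.1 hB).2
    exact (Finset.card_le_card (Finset.inter_subset_inter hAA hBB)).trans
      (hF k j hkj A' hA' B' hB')
  · intro k A hA B hBA
    obtain ⟨A', hA', hAA⟩ := (Finset.mem_filter.1 hA).2
    exact Finset.mem_filter.2 ⟨Finset.mem_univ _, A', hA', hBA.trans hAA⟩
  · intro k A hA
    exact Finset.mem_filter.2 ⟨Finset.mem_univ _, A, hA, le_rfl⟩

theorem exists_minimal_support {m : Fin ℓ → Fin ℓ → ℕ} {F : Fin ℓ → Finset (Finset (Fin n))}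
    (hF : Overlap m F) : ∃ (V : Finset (Fin n)) (G : Fin ℓ → Finset (Finset (Fin n))),
      Overlap m G ∧ (∀ k, ∀ A ∈ G k, ∀ B ⊆ A, B ∈ G k) ∧ (∀ k, G k ⊆ V.powerset) ∧
      (∏ k, (F k).card) * 2 ^ V.card ≤ (∏ k, (G k).card) * 2 ^ n ∧
      ∀ e ∈ V, 2 * ∏ k, ((G k).filter (fun A => e ∉ A)).card ≤ ∏ k, (G k).card := by
  let S : Finset (Finset (Fin n)) := Finset.univ.filter fun V =>
    ∃ G : Fin ℓ → Finset (Finset (Fin n)), Overlap m G ∧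
      (∀ k, ∀ A ∈ G k, ∀ B ⊆ A, B ∈ G k) ∧ (∀ k, G k ⊆ V.powerset) ∧
      (∏ k, (F k).card) * 2 ^ V.card ≤ (∏ k, (G k).card) * 2 ^ n
  have hS : S.Nonempty := by
    obtain ⟨G, hG, hlow, hFG⟩ := exists_lower_overlap hF
    refine ⟨Finset.univ, Finset.mem_filter.2 ⟨Finset.mem_univ _, G, hG, hlow, ?_, ?_⟩⟩
    · intro k A _
      simp
    · rw [Finset.card_univ, Fintype.card_fin]
      exact Nat.mul_le_mul_right _ (Finset.prod_le_prod' fun k _ => Finset.card_le_card (hFG k))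
  obtain ⟨V, hVS, hmin⟩ := Finset.exists_min_image S Finset.card hS
  obtain ⟨G, hG, hlow, hGV, hcard⟩ := (Finset.mem_filter.1 hVS).2
  refine ⟨V, G, hG, hlow, hGV, hcard, fun e he => ?_⟩
  have hnot : V.erase e ∉ S := fun h =>
    absurd (hmin _ h) (not_le.2 (Finset.card_erase_lt_of_mem he))
  have hlt : ¬ ((∏ k, (F k).card) * 2 ^ (V.erase e).card ≤
      (∏ k, ((G k).filter (fun A => e ∉ A)).card) * 2 ^ n) := by
    intro h
    refine hnot (Finset.mem_filter.2 ⟨Finset.mem_univ _,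
      fun k => (G k).filter (fun A => e ∉ A), ?_, ?_, ?_, h⟩)
    · intro k j hkj A hA B hB
      exact hG k j hkj A (Finset.mem_filter.1 hA).1 B (Finset.mem_filter.1 hB).1
    · intro k A hA B hBA
      obtain ⟨h1, h2⟩ := Finset.mem_filter.1 hA
      exact Finset.mem_filter.2 ⟨hlow k A h1 B hBA, fun h => h2 (hBA h)⟩
    · intro k A hA
      obtain ⟨h1, h2⟩ := Finset.mem_filter.1 hA
      exact Finset.mem_powerset.2
        (Finset.subset_erase.2 ⟨Finset.mem_powerset.1 (hGV k h1), h2⟩)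
  rw [not_le] at hlt
  have hV : 2 ^ V.card = 2 * 2 ^ (V.erase e).card := by
    rw [← Finset.card_erase_add_one he, pow_succ, mul_comm]
  rw [hV] at hcard
  refine Nat.le_of_mul_le_mul_right (c := 2 ^ n) ?_ (Nat.two_pow_pos n)
  nlinarith

theorem exists_const_prod_card_le (hℓ : 2 ≤ ℓ) {m : Fin ℓ → Fin ℓ → ℕ}
    (hsym : ∀ k j, m k j = m j k) {s : ℕ} (hs : ∑ q ∈ pairs ℓ, m q.1 q.2 = s) (hs0 : 0 < s)
    {c : ℝ} (hc : c = ∏ p ∈ pairs ℓ,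
      ((Nat.factorial (m p.1 p.2) : ℝ))⁻¹ * ((m p.1 p.2 : ℝ) / s) ^ m p.1 p.2) :
    ∃ C : ℝ, 0 ≤ C ∧ ∀ n : ℕ, 1 ≤ n → ∀ F : Fin ℓ → Finset (Finset (Fin n)), Overlap m F →
      ∏ k, ((F k).card : ℝ) ≤ (1 + C / √(n : ℝ)) * (2 ^ n * (c * (n : ℝ) ^ s)) := by
  have hs0' : (0 : ℝ) < s := by exact_mod_cast hs0
  have hc0 : 0 < c := by
    rw [hc]
    refine Finset.prod_pos fun p _ => mul_pos (by positivity) ?_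
    rcases Nat.eq_zero_or_pos (m p.1 p.2) with h | h
    · rw [h]
      simp
    · positivity
  obtain ⟨K, hK⟩ : ∃ K : ℝ, K = 4 * ℓ ^ 2 * ((s + 1) ^ s / c) := ⟨_, rfl⟩
  obtain ⟨L, hL⟩ : ∃ L : ℝ, L = 2 * ℓ * ((s + 1) ^ s / c) + 1 := ⟨_, rfl⟩
  have hK0 : 0 ≤ K := by rw [hK]; positivity
  have hL0 : 0 ≤ L := by rw [hL]; positivity
  obtain ⟨R, hR⟩ : ∃ R : ℝ, R = ℓ * L + (∑ k, ∑ j, (2 : ℝ) ^ (m k j + 1)) * K := ⟨_, rfl⟩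
  have hR0 : 0 ≤ R := by rw [hR]; positivity
  obtain ⟨T, hT⟩ : ∃ T : ℝ, T = (1 + s : ℝ) ^ s * s * s := ⟨_, rfl⟩
  have hT0 : 0 ≤ T := by rw [hT]; positivity
  refine ⟨T + (R * (s + 1) ^ s + 1) / c, by positivity, fun n hn F hF => ?_⟩
  have hn' : (1 : ℝ) ≤ n := by exact_mod_cast hn
  have hn0 : (0 : ℝ) < n := by linarith
  have hsq : 0 < √(n : ℝ) := Real.sqrt_pos.2 hn0
  have hns : 1 ≤ (n : ℝ) ^ s / √(n : ℝ) := by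
    simpa using pow_div_sqrt_mono hs0 le_rfl hn
  obtain ⟨P, hP⟩ : ∃ P : ℝ, P = ∏ k, ((F k).card : ℝ) := ⟨_, rfl⟩
  rw [← hP]
  suffices h : P ≤ 2 ^ n * (c * (1 + T / √(n : ℝ)) * (n : ℝ) ^ s +
      (R * (s + 1) ^ s + 1) * ((n : ℝ) ^ s / √(n : ℝ))) by
    refine h.trans (le_of_eq ?_)
    field_simp
    ring
  by_cases hsmall : P ≤ 2 ^ n * (c * (n : ℝ) ^ s)
  · refine hsmall.trans ?_
    refine mul_le_mul_of_nonneg_left ?_ (by positivity)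
    have h1 : c * (n : ℝ) ^ s ≤ c * (1 + T / √(n : ℝ)) * (n : ℝ) ^ s := by
      refine mul_le_mul_of_nonneg_right ?_ (by positivity)
      exact le_mul_of_one_le_right hc0.le (by linarith [div_nonneg hT0 hsq.le])
    have h2 : 0 ≤ (R * (s + 1) ^ s + 1) * ((n : ℝ) ^ s / √(n : ℝ)) := by positivity
    linarith
  rw [not_le] at hsmall
  obtain ⟨V, G, hG, hlow, hGV, hPG, hE⟩ := exists_minimal_support hF
  obtain ⟨M, hM⟩ : ∃ M : ℝ, M = ∏ k, ((G k).card : ℝ) := ⟨_, rfl⟩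
  have hPM : P * 2 ^ V.card ≤ M * 2 ^ n := by
    rw [hP, hM]
    exact_mod_cast hPG
  have hvn : V.card ≤ n := by simpa using Finset.card_le_univ V
  obtain ⟨v, hv⟩ : ∃ v : ℕ, v = V.card := ⟨_, rfl⟩
  rw [← hv] at hPM hvn
  have h2v : (0 : ℝ) < 2 ^ v := by positivity
  have h2n : (0 : ℝ) < 2 ^ n := by positivity
  suffices h : M ≤ 2 ^ v * (c * (1 + T / √(n : ℝ)) * (n : ℝ) ^ s +
      (R * (s + 1) ^ s + 1) * ((n : ℝ) ^ s / √(n : ℝ))) by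
    refine le_of_mul_le_mul_right ?_ h2v
    refine hPM.trans ((mul_le_mul_of_nonneg_right h h2n.le).trans (le_of_eq ?_))
    ring
  have hcT : 0 ≤ c * (1 + T / √(n : ℝ)) * (n : ℝ) ^ s := by positivity
  rcases Nat.eq_zero_or_pos v with hv0 | hv1
  · have h1 : M ≤ 1 := by
      rw [hM]
      refine Finset.prod_le_one (fun _ _ => Nat.cast_nonneg _) fun k _ => ?_
      have h2 := Finset.card_le_card (hGV k)
      rw [Finset.card_powerset, ← hv, hv0, pow_zero] at h2
      exact_mod_cast h2
    have h3 : 0 ≤ R * (s + 1) ^ s * ((n : ℝ) ^ s / √(n : ℝ)) := by positivity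
    rw [hv0, pow_zero]
    linarith
  have hv1' : (0 : ℝ) < v := by exact_mod_cast hv1
  have hvn' : (v : ℝ) ≤ n := by exact_mod_cast hvn
  have hcM : c * (2 ^ v * (v : ℝ) ^ s) ≤ M := by
    refine le_of_mul_le_mul_right ?_ h2n
    refine le_trans ?_ ((mul_le_mul_of_nonneg_right hsmall.le h2v.le).trans hPM)
    calc c * (2 ^ v * (v : ℝ) ^ s) * 2 ^ n ≤ c * (2 ^ v * (n : ℝ) ^ s) * 2 ^ n := by gcongr
      _ = _ := by ring
  obtain ⟨d, t, hdt, h1⟩ := exists_dominant_maps hℓ hG V hGV (by omega) hs hc0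
    (by rw [← hv, ← hM]; exact hcM) hE
  have h2 := prod_card_le_of_dominant hsym hG hlow V hGV (by omega) hdt hK0
    (by rw [hK]; exact fun e he => (h1 e he).1) (by rw [hL]; exact fun e he => (h1 e he).2) hL0
  rw [← hM, ← hv, ← hR] at h2
  have h3 : M ≤ (s + 1) ^ s * 2 ^ v * (v : ℝ) ^ s := by
    have h4 := prod_card_le hG V hGV (by omega) hs.le
    rw [hs, ← hv] at h4
    rw [hM]
    exact_mod_cast h4
  have h5 : ∑ p ∈ pairs ℓ, (V.filter (fun e => sortedPair (d e) (t e) = p)).card ≤ v := by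
    rw [hv]
    exact (Finset.card_eq_sum_card_fiberwise
      (fun e _ => sortedPair_mem_pairs (hdt e))).ge
  have h6 := prod_choose_le (pairs ℓ) (fun p => m p.1 p.2)
    (fun p => (V.filter (fun e => sortedPair (d e) (t e) = p)).card) hs0 hs h5
  rw [← hc] at h6
  have h7 : ((v : ℝ) + s) ^ s ≤ (1 + T / √(n : ℝ)) * (n : ℝ) ^ s := by
    rw [hT]
    refine le_trans ?_ (add_pow_le_one_add_div_mul hn)
    gcongr
  have h8 : R / √(v : ℝ) * M ≤ 2 ^ v * (R * (s + 1) ^ s * ((n : ℝ) ^ s / √(n : ℝ))) := by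
    calc R / √(v : ℝ) * M ≤ R / √(v : ℝ) * ((s + 1) ^ s * 2 ^ v * (v : ℝ) ^ s) := by gcongr
      _ = 2 ^ v * (R * (s + 1) ^ s * ((v : ℝ) ^ s / √(v : ℝ))) := by ring
      _ ≤ _ := by
        refine mul_le_mul_of_nonneg_left ?_ h2v.le
        exact mul_le_mul_of_nonneg_left (pow_div_sqrt_mono hs0 hv1 hvn) (by positivity)
  have h9 := mul_le_mul_of_nonneg_left (h6.trans (mul_le_mul_of_nonneg_left h7 hc0.le)) h2v.le
  have h10 : 0 ≤ (2 : ℝ) ^ v * ((n : ℝ) ^ s / √(n : ℝ)) := by positivity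
  linarith

theorem exists_assignment {ι : Type*} [DecidableEq ι] {s : Finset ι} (hs : s.Nonempty) {b : ι → ℕ}
    (hb : ∑ i ∈ s, b i ≤ n) : ∃ S : Fin n → ι, (∀ e, S e ∈ s) ∧
      ∀ i ∈ s, b i ≤ (Finset.univ.filter (fun e => S e = i)).card := by
  obtain ⟨i₀, hi₀⟩ := hs
  have hcard : Fintype.card (Σ i : s, Fin (b i)) ≤ Fintype.card (Fin n) := by
    rw [Fintype.card_sigma, Fintype.card_fin]
    simpa [Finset.sum_attach s b] using hb
  obtain ⟨f⟩ := Function.Embedding.nonempty_of_card_le hcard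
  refine ⟨fun e => (Function.extend f (fun x => x.1) (fun _ => ⟨i₀, hi₀⟩) e).1,
    fun e => Subtype.prop _, fun i hi => ?_⟩
  have h1 : ((Finset.univ : Finset (Fin (b i))).image (fun x => f ⟨⟨i, hi⟩, x⟩)).card = b i := by
    rw [Finset.card_image_of_injective, Finset.card_univ, Fintype.card_fin]
    intro x y hxy
    simpa using f.injective hxy
  rw [← h1]
  refine Finset.card_le_card ?_
  intro e he
  obtain ⟨x, -, rfl⟩ := Finset.mem_image.1 he
  refine Finset.mem_filter.2 ⟨Finset.mem_univ _, ?_⟩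
  simp only [f.injective.extend_apply]

theorem bddAbove_prod_card (n : ℕ) (m : Fin ℓ → Fin ℓ → ℕ) :
    BddAbove {P : ℕ | ∃ F : Fin ℓ → Finset (Finset (Fin n)),
      Overlap m F ∧ P = ∏ k, (F k).card} := by
  refine ⟨∏ _k : Fin ℓ, Fintype.card (Finset (Fin n)), ?_⟩
  rintro _ ⟨F, -, rfl⟩
  exact Finset.prod_le_prod' fun k _ => Finset.card_le_univ _

theorem two_pow_mul_prod_choose_le_sStar {m : Fin ℓ → Fin ℓ → ℕ} (hsym : ∀ k j, m k j = m j k)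
    {S : Fin n → Fin ℓ × Fin ℓ} (hS : ∀ e, S e ∈ pairs ℓ) :
    2 ^ n * ∏ p ∈ pairs ℓ,
      ((Finset.univ.filter (fun e => S e = p)).card).choose (m p.1 p.2) ≤ sStar n ℓ m := by
  have hlt : ∀ e, (S e).1 < (S e).2 := fun e => by simpa [pairs] using hS e
  let U : Fin ℓ × Fin ℓ → Finset (Fin n) := fun p => Finset.univ.filter (fun e => S e = p)
  let F : Fin ℓ → Finset (Finset (Fin n)) := fun k => Finset.univ.filter fun A =>
    (∀ e ∈ A, k = (S e).1 ∨ k = (S e).2) ∧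
      ∀ p ∈ pairs ℓ, p.2 = k → (A ∩ U p).card ≤ m p.1 p.2
  have hF : Overlap m F := by
    intro k j hkj A hA B hB
    have hA := (Finset.mem_filter.1 hA).2
    have hB := (Finset.mem_filter.1 hB).2
    rcases lt_or_gt_of_ne hkj with h | h
    · refine (Finset.card_le_card ?_).trans (hB.2 (k, j) (by simpa [pairs] using h) rfl)
      intro e he
      obtain ⟨heA, heB⟩ := Finset.mem_inter.1 he
      refine Finset.mem_inter.2 ⟨heB, Finset.mem_filter.2 ⟨Finset.mem_univ _, ?_⟩⟩
      have := hlt e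
      ext1
      · rcases hA.1 e heA with h1 | h1 <;> rcases hB.1 e heB with h2 | h2 <;> grind
      · rcases hA.1 e heA with h1 | h1 <;> rcases hB.1 e heB with h2 | h2 <;> grind
    · rw [hsym]
      refine (Finset.card_le_card ?_).trans (hA.2 (j, k) (by simpa [pairs] using h) rfl)
      intro e he
      obtain ⟨heA, heB⟩ := Finset.mem_inter.1 he
      refine Finset.mem_inter.2 ⟨heA, Finset.mem_filter.2 ⟨Finset.mem_univ _, ?_⟩⟩
      have := hlt e
      ext1
      · rcases hA.1 e heA with h1 | h1 <;> rcases hB.1 e heB with h2 | h2 <;> grind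
      · rcases hA.1 e heA with h1 | h1 <;> rcases hB.1 e heB with h2 | h2 <;> grind
  refine le_trans ?_ (le_csSup (bddAbove_prod_card n m) ⟨F, hF, rfl⟩)
  let W : Fin ℓ × Fin ℓ → Finset (Finset (Fin n)) := fun p =>
    if p ∈ pairs ℓ then Finset.powersetCard (m p.1 p.2) (U p) else {∅}
  have hWU : ∀ p, ∀ Q ∈ W p, Q ⊆ U p := by
    intro p Q hQ
    by_cases hp : p ∈ pairs ℓ
    · simp only [W, if_pos hp] at hQ
      exact (Finset.mem_powersetCard.1 hQ).1
    · simp only [W, if_neg hp, Finset.mem_singleton] at hQ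
      simp [hQ]
  have hW : ((Finset.univ : Finset (Finset (Fin n))) ×ˢ Fintype.piFinset W).card =
      2 ^ n * ∏ p ∈ pairs ℓ, (U p).card.choose (m p.1 p.2) := by
    rw [Finset.card_product, Fintype.card_piFinset, Finset.card_univ, Fintype.card_finset,
      Fintype.card_fin]
    congr 1
    rw [← Finset.prod_subset (Finset.subset_univ (pairs ℓ))]
    · refine Finset.prod_congr rfl fun p hp => ?_
      simp only [W, if_pos hp, Finset.card_powersetCard]
    · intro p _ hp
      simp only [W, if_neg hp, Finset.card_singleton]
  rw [← hW, ← Fintype.card_piFinset]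
  let f : Finset (Fin n) × (Fin ℓ × Fin ℓ → Finset (Fin n)) → Fin ℓ → Finset (Fin n) :=
    fun x k => Finset.univ.filter fun e =>
      ((S e).1 = k ∧ e ∈ x.1) ∨ ((S e).2 = k ∧ e ∈ x.2 (S e))
  have hf1 : ∀ x e, e ∈ f x (S e).1 ↔ e ∈ x.1 := by
    intro x e
    simp [f, (hlt e).ne']
  have hf2 : ∀ x e, e ∈ f x (S e).2 ↔ e ∈ x.2 (S e) := by
    intro x e
    simp [f, (hlt e).ne]
  refine Finset.card_le_card_of_injOn f ?_ ?_
  · rintro ⟨X, Q⟩ hx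
    have hQ := Fintype.mem_piFinset.1 (Finset.mem_product.1 (Finset.mem_coe.1 hx)).2
    rw [Finset.mem_coe, Fintype.mem_piFinset]
    intro k
    refine Finset.mem_filter.2 ⟨Finset.mem_univ _, ?_, ?_⟩
    · intro e he
      rcases (Finset.mem_filter.1 he).2 with h | h
      · exact Or.inl h.1.symm
      · exact Or.inr h.1.symm
    · rintro p hp rfl
      have hQp := hQ p
      simp only [W, if_pos hp] at hQp
      rw [← (Finset.mem_powersetCard.1 hQp).2]
      refine Finset.card_le_card ?_
      intro e he
      obtain ⟨h1, h2⟩ := Finset.mem_inter.1 he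
      obtain rfl : S e = p := (Finset.mem_filter.1 h2).2
      exact (hf2 (X, Q) e).1 h1
  · rintro ⟨X, Q⟩ hx ⟨Y, R⟩ hy hxy
    have hQ := Fintype.mem_piFinset.1 (Finset.mem_product.1 (Finset.mem_coe.1 hx)).2
    have hR := Fintype.mem_piFinset.1 (Finset.mem_product.1 (Finset.mem_coe.1 hy)).2
    refine Prod.ext ?_ ?_
    · ext e
      exact (hf1 (X, Q) e).symm.trans ((Finset.ext_iff.1 (congrFun hxy (S e).1) e).trans
        (hf1 (Y, R) e))
    · have hmem : ∀ e, e ∈ Q (S e) ↔ e ∈ R (S e) := fun e =>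
        (hf2 (X, Q) e).symm.trans ((Finset.ext_iff.1 (congrFun hxy (S e).2) e).trans
          (hf2 (Y, R) e))
      funext p
      ext e
      constructor
      · intro he
        obtain rfl : S e = p := (Finset.mem_filter.1 (hWU p _ (hQ p) he)).2
        exact (hmem e).1 he
      · intro he
        obtain rfl : S e = p := (Finset.mem_filter.1 (hWU p _ (hR p) he)).2
        exact (hmem e).2 he

theorem mul_pow_le_choose {a u n σ : ℕ} (hσ : 0 < σ) (hσn : σ ≤ n)
    (hu : a * n / σ ≤ u) :
    ((Nat.factorial a : ℝ))⁻¹ * ((a : ℝ) * n / σ) ^ a * (1 - (σ : ℝ) / n) ^ a ≤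
      ((u.choose a : ℕ) : ℝ) := by
  have hσ' : (0 : ℝ) < σ := by exact_mod_cast hσ
  have hn' : (0 : ℝ) < n := by exact_mod_cast (by omega : 0 < n)
  have hσn' : (σ : ℝ) ≤ n := by exact_mod_cast hσn
  have h1 : a ≤ u := by
    refine le_trans ?_ hu
    rw [Nat.le_div_iff_mul_le hσ]
    exact Nat.mul_le_mul_left _ hσn
  have h2 : (a : ℝ) * n / σ ≤ u + 1 := by
    rw [div_le_iff₀ hσ']
    have h3 : a * n < σ * (u + 1) := by
      have := Nat.lt_mul_div_succ (a * n) hσ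
      nlinarith
    have h4 : ((a * n : ℕ) : ℝ) ≤ ((σ * (u + 1) : ℕ) : ℝ) := by exact_mod_cast h3.le
    push_cast at h4
    linarith
  refine le_trans ?_ (Nat.pow_le_choose (α := ℝ) a u)
  rw [mul_assoc, ← mul_pow]
  refine le_of_le_of_eq ?_ (div_eq_inv_mul _ _).symm
  refine mul_le_mul_of_nonneg_left ?_ (by positivity)
  have hx : 0 ≤ 1 - (σ : ℝ) / n := sub_nonneg.2 ((div_le_one hn').2 hσn')
  have hy : 0 ≤ (a : ℝ) * n / σ * (1 - σ / n) := mul_nonneg (by positivity) hx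
  refine pow_le_pow_left₀ hy ?_ _
  rw [Nat.cast_sub (by omega : a ≤ u + 1)]
  push_cast
  have h3 : (a : ℝ) * n / σ * (1 - σ / n) = a * n / σ - a := by
    field_simp
  rw [h3]
  linarith

theorem prod_le_sStar (hℓ : 2 ≤ ℓ) {m : Fin ℓ → Fin ℓ → ℕ} (hsym : ∀ k j, m k j = m j k)
    {s : ℕ} (hs : ∑ q ∈ pairs ℓ, m q.1 q.2 = s) (hs0 : 0 < s) (hn : 1 ≤ n) :
    (1 - (s : ℝ) ^ 2 / √(n : ℝ)) * (2 ^ n * ∏ p ∈ pairs ℓ,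
      ((Nat.factorial (m p.1 p.2) : ℝ))⁻¹ * ((m p.1 p.2 : ℝ) * n / s) ^ m p.1 p.2) ≤
      (sStar n ℓ m : ℝ) := by
  have hn' : (1 : ℝ) ≤ n := by exact_mod_cast hn
  have hn0 : (0 : ℝ) < n := by linarith
  have hs1 : (1 : ℝ) ≤ s := by exact_mod_cast hs0
  have hsq : 0 < √(n : ℝ) := Real.sqrt_pos.2 hn0
  have hsqn : √(n : ℝ) ≤ n := by
    rw [Real.sqrt_le_left hn0.le]
    nlinarith
  have hP : 0 ≤ 2 ^ n * ∏ p ∈ pairs ℓ,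
      ((Nat.factorial (m p.1 p.2) : ℝ))⁻¹ * ((m p.1 p.2 : ℝ) * n / s) ^ m p.1 p.2 :=
    mul_nonneg (by positivity) (Finset.prod_nonneg fun p _ => by positivity)
  rcases lt_or_ge n s with hns | hns
  · have hns' : (n : ℝ) ≤ s := by exact_mod_cast hns.le
    refine le_trans (mul_nonpos_of_nonpos_of_nonneg ?_ hP) (Nat.cast_nonneg _)
    rw [sub_nonpos, one_le_div hsq]
    nlinarith
  have hns' : (s : ℝ) ≤ n := by exact_mod_cast hns
  have hne : (pairs ℓ).Nonempty :=
    ⟨(⟨0, by omega⟩, ⟨1, by omega⟩), by simp [pairs]⟩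
  have hb : ∑ p ∈ pairs ℓ, m p.1 p.2 * n / s ≤ n := by
    rw [← Nat.mul_le_mul_left_iff hs0, Finset.mul_sum]
    refine (Finset.sum_le_sum fun p _ => Nat.mul_div_le _ _).trans ?_
    rw [← Finset.sum_mul, hs]
  obtain ⟨S, hS, hSb⟩ := exists_assignment hne hb
  have h1 : (2 : ℝ) ^ n * ∏ p ∈ pairs ℓ,
      (((Finset.univ.filter (fun e => S e = p)).card.choose (m p.1 p.2) : ℕ) : ℝ) ≤
      (sStar n ℓ m : ℝ) := by
    exact_mod_cast two_pow_mul_prod_choose_le_sStar hsym hS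
  refine le_trans ?_ h1
  have hx : 0 ≤ 1 - (s : ℝ) / n := sub_nonneg.2 ((div_le_one hn0).2 hns')
  have h2 := Finset.prod_le_prod (s := pairs ℓ) (fun p _ => by positivity)
    fun p hp => mul_pow_le_choose hs0 hns (hSb p hp)
  rw [Finset.prod_mul_distrib, Finset.prod_pow_eq_pow_sum, hs] at h2
  have h3 : 1 - (s : ℝ) ^ 2 / √(n : ℝ) ≤ (1 - (s : ℝ) / n) ^ s := by
    have h4 := one_add_mul_le_pow (a := -((s : ℝ) / n)) (by linarith) s
    have h5 : (s : ℝ) ^ 2 / n ≤ (s : ℝ) ^ 2 / √(n : ℝ) := by gcongr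
    have h6 : (s : ℝ) * (s / n) = s ^ 2 / n := by ring
    rw [← sub_eq_add_neg] at h4
    linarith
  refine (mul_le_mul_of_nonneg_right h3 hP).trans ?_
  rw [mul_left_comm, mul_comm _ (Finset.prod _ _)]
  exact mul_le_mul_of_nonneg_left h2 (by positivity)

end

/-- For fixed `ℓ ≥ 2` and a symmetric not-all-zero vector `𝐦`,
with `σ = Σ_S 𝐦_S` and `P(n) = 2^n · Π_S (1/𝐦_S!)·(𝐦_S·n/σ)^{𝐦_S}`, there is `C > 0`
with `(1 − C/√n)·P(n) ≤ s*(n,ℓ,𝐦) ≤ (1 + C/√n)·P(n)` for all `n ≥ 1`. -/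
theorem sStar_asymptotics_sqrt (ℓ : ℕ) (hℓ : 2 ≤ ℓ) (m : Fin ℓ → Fin ℓ → ℕ)
    (hsym : ∀ k1 k2, m k1 k2 = m k2 k1)
    (hnz : ∃ k1 k2 : Fin ℓ, k1 ≠ k2 ∧ 0 < m k1 k2) :
    ∃ C : ℝ, 0 < C ∧ ∀ n : ℕ, 1 ≤ n →
      (1 - C / Real.sqrt n) *
          (2 ^ n * ∏ p ∈ pairs ℓ,
            ((Nat.factorial (m p.1 p.2) : ℝ))⁻¹ *
              ((m p.1 p.2 : ℝ) * n / ((∑ q ∈ pairs ℓ, m q.1 q.2 : ℕ) : ℝ)) ^ (m p.1 p.2))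
        ≤ (sStar n ℓ m : ℝ) ∧
      (sStar n ℓ m : ℝ) ≤
        (1 + C / Real.sqrt n) *
          (2 ^ n * ∏ p ∈ pairs ℓ,
            ((Nat.factorial (m p.1 p.2) : ℝ))⁻¹ *
              ((m p.1 p.2 : ℝ) * n / ((∑ q ∈ pairs ℓ, m q.1 q.2 : ℕ) : ℝ)) ^ (m p.1 p.2)) := by
  obtain ⟨s, hs⟩ : ∃ s, ∑ q ∈ pairs ℓ, m q.1 q.2 = s := ⟨_, rfl⟩
  have hs0 : 0 < s := by
    obtain ⟨k, j, hkj, hpos⟩ := hnz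
    have h1 : 0 < m (sortedPair k j).1 (sortedPair k j).2 := by
      rcases le_total k j with h | h
      · simpa [sortedPair, h] using hpos
      · simpa [sortedPair, h, hsym j k] using hpos
    rw [← hs]
    exact h1.trans_le (Finset.single_le_sum (f := fun p : Fin ℓ × Fin ℓ => m p.1 p.2)
      (fun _ _ => Nat.zero_le _) (sortedPair_mem_pairs hkj))
  have hs0' : (0 : ℝ) < s := by exact_mod_cast hs0
  rw [hs]
  obtain ⟨C, hC, hupper⟩ := exists_const_prod_card_le hℓ hsym hs hs0 rfl
  refine ⟨C + (s : ℝ) ^ 2, by positivity, fun n hn => ?_⟩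
  have hP : 0 ≤ 2 ^ n * ∏ p ∈ pairs ℓ,
      ((Nat.factorial (m p.1 p.2) : ℝ))⁻¹ * ((m p.1 p.2 : ℝ) * n / s) ^ m p.1 p.2 :=
    mul_nonneg (by positivity) (Finset.prod_nonneg fun p _ => by positivity)
  constructor
  · refine le_trans (mul_le_mul_of_nonneg_right ?_ hP) (prod_le_sStar hℓ hsym hs hs0 hn)
    gcongr
    linarith
  · obtain ⟨F, hF, hmax⟩ := Nat.sSup_mem (s := {P : ℕ | ∃ F : Fin ℓ → Finset (Finset (Fin n)),
      Overlap m F ∧ P = ∏ k, (F k).card}) ⟨_, fun _ => ∅, by simp [Overlap], rfl⟩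
      (bddAbove_prod_card n m)
    have h1 : (sStar n ℓ m : ℝ) = ∏ k, ((F k).card : ℝ) := by
      rw [sStar, hmax, Nat.cast_prod]
    rw [h1]
    refine (hupper n hn F hF).trans ?_
    rw [← prod_mul_div_pow (pairs ℓ) (fun p => m p.1 p.2) _ hs]
    refine mul_le_mul_of_nonneg_right ?_ hP
    gcongr
    linarith [sq_nonneg (s : ℝ)]

end
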